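/- Assume there is ε ∈ (0,1) with ‖K* − K̄‖_F ≤ (ε/2)·√(λ_min(Γ)) / (√(λ_min(Γ))·‖S B_a‖_F + ‖S B_u‖_F). Then the set S₀ is a compact subset of ℝ^{m_u×n} (it is closed and bounded). -/

import Mathlib

open Matrix Filter Topology

noncomputable section

/-- A real square matrix is Hurwitz if every complex eigenvalue has strictly
negative real part. -/
def IsHurwitz {N : ℕ} (M : Matrix (Fin N) (Fin N) ℝ) : Prop :=
  ∀ μ : ℂ, μ ∈ spectrum ℂ (M.map (algebraMap ℝ ℂ)) → μ.re < 0

/-- Frobenius norm of a real matrix. -/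
def frobNorm {p q : ℕ} (M : Matrix (Fin p) (Fin q) ℝ) : ℝ :=
  Real.sqrt (Matrix.trace (Mᵀ * M))

/-- Minimal eigenvalue of a (Hermitian) real matrix. -/
def eigMin {m : ℕ} (M : Matrix (Fin m) (Fin m) ℝ) : ℝ :=
  if hM : M.IsHermitian then ⨅ i, hM.eigenvalues i else 0

/-- Maximal eigenvalue of a (Hermitian) real matrix. -/
def eigMax {m : ℕ} (M : Matrix (Fin m) (Fin m) ℝ) : ℝ :=
  if hM : M.IsHermitian then ⨆ i, hM.eigenvalues i else 0

variable {n m_u m_a : ℕ}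

/-- `P` is the stabilizing solution of the spoofed ARE for the gain `Λ`. -/
def IsStabSol (A : Matrix (Fin n) (Fin n) ℝ) (Bu : Matrix (Fin n) (Fin m_u) ℝ)
    (Ba : Matrix (Fin n) (Fin m_a) ℝ) (Q : Matrix (Fin n) (Fin n) ℝ)
    (R : Matrix (Fin m_a) (Fin m_a) ℝ)
    (Λ : Matrix (Fin m_u) (Fin n) ℝ) (P : Matrix (Fin n) (Fin n) ℝ) : Prop :=
  P.PosDef ∧
  (A + Bu * Λ)ᵀ * P + P * (A + Bu * Λ) + Q + P * Ba * R⁻¹ * Baᵀ * P = 0 ∧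
  IsHurwitz (A + Bu * Λ + Ba * R⁻¹ * Baᵀ * P)

/-- `Pim` is a symmetric solution of the Lyapunov equation defining `Π(Λ)`,
given the stabilizing ARE solution `P = P_u(Λ)`. -/
def IsLyapSol (A : Matrix (Fin n) (Fin n) ℝ) (Bu : Matrix (Fin n) (Fin m_u) ℝ)
    (Ba : Matrix (Fin n) (Fin m_a) ℝ) (R : Matrix (Fin m_a) (Fin m_a) ℝ)
    (Kbar : Matrix (Fin m_a) (Fin n) ℝ)
    (Λ : Matrix (Fin m_u) (Fin n) ℝ) (P Pim : Matrix (Fin n) (Fin n) ℝ) : Prop :=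
  Pim.IsHermitian ∧
  (A + Bu * Λ + Ba * R⁻¹ * Baᵀ * P) * Pim + Pim * (A + Bu * Λ + Ba * R⁻¹ * Baᵀ * P)ᵀ
    - Kbarᵀ * R⁻¹ * Baᵀ - Ba * R⁻¹ * Kbar
    + P * Ba * (R⁻¹ * R⁻¹) * Baᵀ + Ba * (R⁻¹ * R⁻¹) * Baᵀ * P = 0

/-- The deception cost `J̃(Λ)`, expressed through a choice function `Pu` for the
stabilizing solution of the spoofed ARE. -/
def Jcost (Ba : Matrix (Fin n) (Fin m_a) ℝ) (R : Matrix (Fin m_a) (Fin m_a) ℝ)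
    (Γ : Matrix (Fin m_u) (Fin m_u) ℝ) (Kbar : Matrix (Fin m_a) (Fin n) ℝ)
    (Pu : Matrix (Fin m_u) (Fin n) ℝ → Matrix (Fin n) (Fin n) ℝ)
    (Λ : Matrix (Fin m_u) (Fin n) ℝ) : ℝ :=
  frobNorm (R⁻¹ * Baᵀ * Pu Λ - Kbar) ^ 2 + Matrix.trace (Λᵀ * Γ * Λ)

/-- The sublevel set `S₀`. -/
def S0 (A : Matrix (Fin n) (Fin n) ℝ) (Bu : Matrix (Fin n) (Fin m_u) ℝ)
    (Ba : Matrix (Fin n) (Fin m_a) ℝ) (Q : Matrix (Fin n) (Fin n) ℝ)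
    (R : Matrix (Fin m_a) (Fin m_a) ℝ) (Γ : Matrix (Fin m_u) (Fin m_u) ℝ)
    (Kbar : Matrix (Fin m_a) (Fin n) ℝ)
    (Pu : Matrix (Fin m_u) (Fin n) ℝ → Matrix (Fin n) (Fin n) ℝ) :
    Set (Matrix (Fin m_u) (Fin n) ℝ) :=
  {Λ | (∃ P, IsStabSol A Bu Ba Q R Λ P) ∧
    Jcost Ba R Γ Kbar Pu Λ ≤ Jcost Ba R Γ Kbar Pu 0}

section frobNorm

variable {p q r : ℕ}

lemma frobNorm_nonneg (M : Matrix (Fin p) (Fin q) ℝ) : 0 ≤ frobNorm M := Real.sqrt_nonneg _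

lemma frobNorm_eq_sqrt_sum (M : Matrix (Fin p) (Fin q) ℝ) :
    frobNorm M = √(∑ i, ∑ j, M i j ^ 2) := by
  unfold frobNorm
  rw [Finset.sum_comm]
  simp [Matrix.trace, Matrix.mul_apply, sq]

lemma frobNorm_sq (M : Matrix (Fin p) (Fin q) ℝ) : frobNorm M ^ 2 = ∑ i, ∑ j, M i j ^ 2 := by
  rw [frobNorm_eq_sqrt_sum, Real.sq_sqrt]
  positivity

lemma abs_apply_le_frobNorm (M : Matrix (Fin p) (Fin q) ℝ) (i : Fin p) (j : Fin q) :
    |M i j| ≤ frobNorm M := by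
  rw [frobNorm_eq_sqrt_sum]
  apply Real.abs_le_sqrt
  calc M i j ^ 2 ≤ ∑ j, M i j ^ 2 :=
        Finset.single_le_sum (f := fun j => M i j ^ 2) (fun _ _ => sq_nonneg _) (Finset.mem_univ j)
    _ ≤ ∑ i, ∑ j, M i j ^ 2 :=
        Finset.single_le_sum (f := fun i => ∑ j, M i j ^ 2)
          (fun _ _ => Finset.sum_nonneg fun _ _ => sq_nonneg _) (Finset.mem_univ i)

lemma frobNorm_eq_norm (M : Matrix (Fin p) (Fin q) ℝ) :
    letI := Matrix.frobeniusNormedAddCommGroup (m := Fin p) (n := Fin q) (α := ℝ)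
    frobNorm M = ‖M‖ := by
  rw [frobNorm_eq_sqrt_sum, Matrix.frobenius_norm_def, Real.sqrt_eq_rpow]
  simp

lemma frobNorm_mul_le (M : Matrix (Fin p) (Fin q) ℝ) (N : Matrix (Fin q) (Fin r) ℝ) :
    frobNorm (M * N) ≤ frobNorm M * frobNorm N := by
  simp only [frobNorm_eq_norm]
  exact Matrix.frobenius_norm_mul M N

lemma frobNorm_sub_le (M N : Matrix (Fin p) (Fin q) ℝ) :
    frobNorm (M - N) ≤ frobNorm M + frobNorm N := by
  let _ := Matrix.frobeniusNormedAddCommGroup (m := Fin p) (n := Fin q) (α := ℝ)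
  simp only [frobNorm_eq_norm]
  exact norm_sub_le M N

lemma continuous_frobNorm : Continuous (frobNorm : Matrix (Fin p) (Fin q) ℝ → ℝ) := by
  unfold frobNorm
  fun_prop

lemma dotProduct_mulVec_le_frobNorm (M : Matrix (Fin p) (Fin p) ℝ) (x : Fin p → ℝ) :
    x ⬝ᵥ M *ᵥ x ≤ frobNorm M * (x ⬝ᵥ x) := by
  have key : (x ⬝ᵥ M *ᵥ x) ^ 2 ≤ (frobNorm M * (x ⬝ᵥ x)) ^ 2 := by
    rw [mul_pow, frobNorm_sq]
    have h := Finset.sum_mul_sq_le_sq_mul_sq Finset.univ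
      (fun k : Fin p × Fin p => M k.1 k.2) (fun k => x k.1 * x k.2)
    simp only [Fintype.sum_prod_type] at h
    have e₁ : x ⬝ᵥ M *ᵥ x = ∑ i, ∑ j, M i j * (x i * x j) := by
      simp only [dotProduct, Matrix.mulVec, Finset.mul_sum]
      exact Finset.sum_congr rfl fun i _ => Finset.sum_congr rfl fun j _ => by ring
    have e₂ : (x ⬝ᵥ x) ^ 2 = ∑ i, ∑ j, (x i * x j) ^ 2 := by
      rw [sq, dotProduct, Finset.sum_mul_sum]
      exact Finset.sum_congr rfl fun i _ => Finset.sum_congr rfl fun j _ => by ring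
    rwa [e₁, e₂]
  have hx : 0 ≤ x ⬝ᵥ x := by
    simpa [dotProduct] using Finset.sum_nonneg fun i _ => mul_self_nonneg (x i)
  exact (abs_le_of_sq_le_sq' key (mul_nonneg (frobNorm_nonneg M) hx)).2

lemma frobNorm_sq_eq_sum_col (M : Matrix (Fin p) (Fin q) ℝ) :
    frobNorm M ^ 2 = ∑ j, (fun i => M i j) ⬝ᵥ (fun i => M i j) := by
  rw [frobNorm_sq, Finset.sum_comm]
  simp [dotProduct, sq]

lemma trace_transpose_mul_mul_eq_sum_col (Γ : Matrix (Fin p) (Fin p) ℝ)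
    (M : Matrix (Fin p) (Fin q) ℝ) :
    (Mᵀ * Γ * M).trace = ∑ j, (fun i => M i j) ⬝ᵥ Γ *ᵥ (fun i => M i j) := by
  rw [Matrix.mul_assoc]
  simp [Matrix.trace, Matrix.mul_apply, dotProduct, Matrix.mulVec]

end frobNorm

section eigMin

variable {m q : ℕ}

lemma eigMin_mul_dotProduct_le {Γ : Matrix (Fin m) (Fin m) ℝ} (hΓ : Γ.IsHermitian)
    (x : Fin m → ℝ) : eigMin Γ * (x ⬝ᵥ x) ≤ x ⬝ᵥ Γ *ᵥ x := by
  have hH : (Γ - eigMin Γ • (1 : Matrix (Fin m) (Fin m) ℝ)).IsHermitian :=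
    hΓ.sub (by simp [Matrix.IsHermitian])
  have hpsd : (Γ - eigMin Γ • (1 : Matrix (Fin m) (Fin m) ℝ)).PosSemidef := by
    rw [hH.posSemidef_iff_eigenvalues_nonneg]
    intro i
    have hi : hH.eigenvalues i ∈ spectrum ℝ (Γ - eigMin Γ • (1 : Matrix (Fin m) (Fin m) ℝ)) := by
      rw [hH.spectrum_real_eq_range_eigenvalues]
      exact ⟨i, rfl⟩
    have hi' : hH.eigenvalues i + eigMin Γ ∈ spectrum ℝ Γ := by
      rw [spectrum.mem_iff] at hi ⊢
      convert hi using 2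
      rw [map_add, Algebra.algebraMap_eq_smul_one (eigMin Γ)]
      abel
    rw [hΓ.spectrum_real_eq_range_eigenvalues] at hi'
    obtain ⟨k, hk⟩ := hi'
    have hle : eigMin Γ ≤ hΓ.eigenvalues k := by
      rw [eigMin, dif_pos hΓ]
      exact ciInf_le (Set.finite_range _).bddBelow k
    simp only [Pi.zero_apply]
    linarith
  have := hpsd.dotProduct_mulVec_nonneg x
  simp only [star_trivial, Matrix.sub_mulVec, Matrix.smul_mulVec, Matrix.one_mulVec,
    dotProduct_sub, dotProduct_smul, smul_eq_mul] at this
  linarith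

lemma eigMin_pos [Nonempty (Fin m)] {Γ : Matrix (Fin m) (Fin m) ℝ} (hΓ : Γ.PosDef) :
    0 < eigMin Γ := by
  rw [eigMin, dif_pos hΓ.1]
  obtain ⟨i, hi⟩ := exists_eq_ciInf_of_finite (f := hΓ.1.eigenvalues)
  rw [← hi]
  exact hΓ.eigenvalues_pos i

lemma eigMin_mul_frobNorm_sq_le {Γ : Matrix (Fin m) (Fin m) ℝ} (hΓ : Γ.IsHermitian)
    (M : Matrix (Fin m) (Fin q) ℝ) : eigMin Γ * frobNorm M ^ 2 ≤ (Mᵀ * Γ * M).trace := by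
  rw [frobNorm_sq_eq_sum_col, trace_transpose_mul_mul_eq_sum_col, Finset.mul_sum]
  exact Finset.sum_le_sum fun j _ => eigMin_mul_dotProduct_le hΓ _

lemma trace_transpose_mul_mul_nonneg {Γ : Matrix (Fin m) (Fin m) ℝ} (hΓ : Γ.PosDef)
    (M : Matrix (Fin m) (Fin q) ℝ) : 0 ≤ (Mᵀ * Γ * M).trace := by
  rw [trace_transpose_mul_mul_eq_sum_col]
  exact Finset.sum_nonneg fun j _ => by
    simpa using hΓ.posSemidef.dotProduct_mulVec_nonneg fun i => M i j

end eigMin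

section Lyapunov

variable {N : ℕ}

lemma dotProduct_mulVec_comm_of_isHermitian {S : Matrix (Fin N) (Fin N) ℝ} (hS : S.IsHermitian)
    (x y : Fin N → ℝ) : x ⬝ᵥ S *ᵥ y = y ⬝ᵥ S *ᵥ x := by
  have hT : Sᵀ = S := by simpa [Matrix.IsHermitian] using hS
  rw [dotProduct_comm y, Matrix.dotProduct_mulVec, ← Matrix.mulVec_transpose, hT]

lemma dotProduct_lyapunov_mulVec {S : Matrix (Fin N) (Fin N) ℝ} (hS : S.IsHermitian)
    (M : Matrix (Fin N) (Fin N) ℝ) (x : Fin N → ℝ) :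
    x ⬝ᵥ (Mᵀ * S + S * M) *ᵥ x = 2 * (x ⬝ᵥ S *ᵥ (M *ᵥ x)) := by
  rw [Matrix.add_mulVec, dotProduct_add, ← Matrix.mulVec_mulVec, ← Matrix.mulVec_mulVec,
    Matrix.dotProduct_mulVec x Mᵀ, Matrix.vecMul_transpose,
    dotProduct_mulVec_comm_of_isHermitian hS (M *ᵥ x), two_mul]

/-- Lyapunov's criterion: a strict Lyapunov inequality with positive definite certificate implies
stability. -/
lemma isHurwitz_of_lyapunov {S M : Matrix (Fin N) (Fin N) ℝ} (hS : S.PosDef)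
    (h : ∀ x, x ≠ 0 → x ⬝ᵥ S *ᵥ (M *ᵥ x) < 0) : IsHurwitz M := by
  intro μ hμ
  rw [spectrum.mem_iff, Matrix.isUnit_iff_isUnit_det, isUnit_iff_ne_zero, not_not,
    ← Matrix.exists_mulVec_eq_zero_iff] at hμ
  obtain ⟨v, hv0, hv⟩ := hμ
  set x : Fin N → ℝ := fun i => (v i).re with hx
  set y : Fin N → ℝ := fun i => (v i).im with hy
  have hv' : ∀ i, μ * v i = ∑ j, (M i j : ℂ) * v j := by
    intro i
    have := congrFun hv i
    simp only [Matrix.sub_mulVec, Matrix.algebraMap_eq_diagonal, Pi.sub_apply,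
      Matrix.mulVec_diagonal, Pi.zero_apply, sub_eq_zero] at this
    simpa [Matrix.mulVec, dotProduct] using this
  have hMx : M *ᵥ x = μ.re • x - μ.im • y := by
    ext i
    have := congrArg Complex.re (hv' i)
    simp only [Complex.mul_re, Complex.re_sum, Complex.ofReal_re, Complex.ofReal_im, zero_mul,
      sub_zero] at this
    simp [Matrix.mulVec, dotProduct, hx, hy, this]
  have hMy : M *ᵥ y = μ.re • y + μ.im • x := by
    ext i
    have := congrArg Complex.im (hv' i)
    simp only [Complex.mul_im, Complex.im_sum, Complex.ofReal_re, Complex.ofReal_im, zero_mul,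
      add_zero] at this
    simp [Matrix.mulVec, dotProduct, hx, hy, this]
  have hxy : x ≠ 0 ∨ y ≠ 0 := by
    by_contra! hc
    exact hv0 (funext fun i => Complex.ext (congrFun hc.1 i) (congrFun hc.2 i))
  have hle : ∀ z, z ⬝ᵥ S *ᵥ (M *ᵥ z) ≤ 0 := fun z => by
    rcases eq_or_ne z 0 with rfl | hz
    · simp
    · exact (h z hz).le
  have hneg : x ⬝ᵥ S *ᵥ (M *ᵥ x) + y ⬝ᵥ S *ᵥ (M *ᵥ y) < 0 := by
    rcases hxy with h' | h'
    · linarith [h x h', hle y]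
    · linarith [h y h', hle x]
  have hxx := hS.posSemidef.dotProduct_mulVec_nonneg x
  have hyy := hS.posSemidef.dotProduct_mulVec_nonneg y
  have hc := dotProduct_mulVec_comm_of_isHermitian hS.1 x y
  simp only [star_trivial] at hxx hyy
  simp only [hMx, hMy, Matrix.mulVec_sub, Matrix.mulVec_add, Matrix.mulVec_smul, dotProduct_sub,
    dotProduct_add, dotProduct_smul, smul_eq_mul] at hneg
  rw [hc] at hneg
  by_contra! hge
  nlinarith [mul_nonneg hge hxx, mul_nonneg hge hyy]

/-- At a maximiser of the generalised Rayleigh quotient, the form `P` is compared with `S`. -/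
lemma exists_generalized_rayleigh [Nonempty (Fin N)] {S P : Matrix (Fin N) (Fin N) ℝ}
    (hS : S.PosDef) (hP : P.IsHermitian) :
    ∃ (t : ℝ) (v : Fin N → ℝ), v ≠ 0 ∧ P *ᵥ v = t • S *ᵥ v ∧
      ∀ x, x ⬝ᵥ P *ᵥ x ≤ t * (x ⬝ᵥ S *ᵥ x) := by
  have hpos : ∀ x : Fin N → ℝ, x ≠ 0 → 0 < x ⬝ᵥ S *ᵥ x := fun x hx => by
    simpa using hS.dotProduct_mulVec_pos hx
  have hne : ∀ x ∈ Metric.sphere (0 : Fin N → ℝ) 1, x ≠ 0 := fun x hx =>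
    ne_zero_of_mem_unit_sphere ⟨x, hx⟩
  obtain ⟨v, hv, hmax⟩ := (isCompact_sphere (0 : Fin N → ℝ) 1).exists_isMaxOn
    (NormedSpace.sphere_nonempty.2 zero_le_one)
    (f := fun x => (x ⬝ᵥ P *ᵥ x) / (x ⬝ᵥ S *ᵥ x))
    (ContinuousOn.div (by fun_prop) (by fun_prop) fun x hx => (hpos x (hne x hx)).ne')
  set t := (v ⬝ᵥ P *ᵥ v) / (v ⬝ᵥ S *ᵥ v) with ht
  have hall : ∀ x, x ⬝ᵥ P *ᵥ x ≤ t * (x ⬝ᵥ S *ᵥ x) := by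
    intro x
    rcases eq_or_ne x 0 with rfl | hx
    · simp
    have hn : ‖x‖ ≠ 0 := norm_ne_zero_iff.2 hx
    have hxs : ‖x‖⁻¹ • x ∈ Metric.sphere (0 : Fin N → ℝ) 1 := by
      simp [norm_smul, hn]
    have := hmax hxs
    simp only [Set.mem_ofPred_eq, Matrix.mulVec_smul, dotProduct_smul, smul_dotProduct,
      smul_eq_mul] at this
    rw [mul_div_mul_left _ _ (inv_ne_zero hn), mul_div_mul_left _ _ (inv_ne_zero hn),
      div_le_iff₀ (hpos x hx)] at this
    exact this
  refine ⟨t, v, hne v hv, ?_, hall⟩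
  have hpsd : (t • S - P).PosSemidef := by
    refine .of_dotProduct_mulVec_nonneg ((hS.1.smul (by simp [IsSelfAdjoint])).sub hP) fun x => ?_
    have := hall x
    simp only [star_trivial, Matrix.sub_mulVec, Matrix.smul_mulVec, dotProduct_sub,
      dotProduct_smul, smul_eq_mul]
    linarith
  have h0 : (t • S - P) *ᵥ v = 0 := by
    rw [← hpsd.dotProduct_mulVec_zero_iff]
    simp only [star_trivial, Matrix.sub_mulVec, Matrix.smul_mulVec, dotProduct_sub,
      dotProduct_smul, smul_eq_mul]
    rw [ht, div_mul_cancel₀ _ (hpos v (hne v hv)).ne', sub_self]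
  rw [Matrix.sub_mulVec, Matrix.smul_mulVec, sub_eq_zero] at h0
  exact h0.symm

/-- Comparison of Lyapunov certificates along the same flow. -/
lemma dotProduct_mulVec_le_of_lyapunov {S P M : Matrix (Fin N) (Fin N) ℝ} (hS : S.PosDef)
    (hP : P.IsHermitian) {κ q : ℝ} (hκ : 0 < κ) (hq : 0 ≤ q)
    (hSM : ∀ x, x ⬝ᵥ S *ᵥ (M *ᵥ x) ≤ -κ * (x ⬝ᵥ x))
    (hPM : ∀ x, -q * (x ⬝ᵥ x) ≤ x ⬝ᵥ P *ᵥ (M *ᵥ x)) (x : Fin N → ℝ) :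
    x ⬝ᵥ P *ᵥ x ≤ q / κ * (x ⬝ᵥ S *ᵥ x) := by
  rcases isEmpty_or_nonempty (Fin N) with _ | _
  · simp [dotProduct]
  obtain ⟨t, v, hv, hPv, hall⟩ := exists_generalized_rayleigh hS hP
  have hvv : 0 < v ⬝ᵥ v := by simpa using dotProduct_star_self_pos_iff.2 hv
  have htq : t ≤ q / κ := by
    rcases le_or_gt t 0 with h | h
    · exact h.trans (by positivity)
    rw [le_div_iff₀ hκ]
    have h1 := hPM v
    rw [dotProduct_mulVec_comm_of_isHermitian hP, hPv, dotProduct_smul,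
      dotProduct_mulVec_comm_of_isHermitian hS.1, smul_eq_mul] at h1
    have h2 := mul_le_mul_of_nonneg_left (hSM v) h.le
    nlinarith
  have hxx := hS.posSemidef.dotProduct_mulVec_nonneg x
  simp only [star_trivial] at hxx
  exact (hall x).trans (mul_le_mul_of_nonneg_right htq hxx)

end Lyapunov

section Sylvester

variable {N : ℕ}

lemma mul_aeval_eq_aeval_mul {X L D : Matrix (Fin N) (Fin N) ℂ} (h : D * X = L * D)
    (p : Polynomial ℂ) : D * Polynomial.aeval X p = Polynomial.aeval L p * D := by
  induction p using Polynomial.induction_on' with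
  | add p q hp hq => rw [map_add, map_add, mul_add, add_mul, hp, hq]
  | monomial k a =>
    have hk : D * X ^ k = L ^ k * D := (show SemiconjBy D X L from h).pow_right k
    rw [Polynomial.aeval_monomial, Polynomial.aeval_monomial, ← mul_assoc,
      ← Algebra.commutes a D, mul_assoc, hk, mul_assoc]

lemma eq_zero_of_sylvester {X L D : Matrix (Fin N) (Fin N) ℂ} (h : D * X = L * D)
    (hdisj : Disjoint (spectrum ℂ X) (spectrum ℂ L)) : D = 0 := by
  rcases isEmpty_or_nonempty (Fin N) with _ | _
  · exact Subsingleton.elim _ _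
  have h1 := mul_aeval_eq_aeval_mul h X.charpoly
  rw [Matrix.aeval_self_charpoly, mul_zero] at h1
  have hu : IsUnit (Polynomial.aeval L X.charpoly) := by
    rw [← spectrum.zero_notMem_iff ℂ, spectrum.map_polynomial_aeval_of_degree_pos _ _
      (by rw [Matrix.charpoly_degree_eq_dim]; simpa using Fin.pos_iff_nonempty.2 ‹_›)]
    rintro ⟨k, hk, hk0⟩
    exact Set.disjoint_left.1 hdisj (Matrix.mem_spectrum_iff_isRoot_charpoly.2 hk0) hk
  exact (hu.mul_right_eq_zero).1 h1.symm

lemma eq_zero_of_isHurwitz_sylvester {M₁ M₂ D : Matrix (Fin N) (Fin N) ℝ} (h₁ : IsHurwitz M₁)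
    (h₂ : IsHurwitz M₂) (h : M₁ᵀ * D + D * M₂ = 0) : D = 0 := by
  let f := (Complex.ofRealHom).mapMatrix (m := Fin N)
  have hf : Function.Injective f := Matrix.map_injective Complex.ofReal_injective
  apply hf
  rw [map_zero]
  refine eq_zero_of_sylvester (X := f M₂) (L := -f M₁ᵀ) ?_ ?_
  · rw [neg_mul, ← map_mul, ← map_mul, ← map_neg, eq_neg_of_add_eq_zero_right h]
  · rw [Set.disjoint_left]
    intro μ hμ hμ'
    have h2 := h₂ μ hμ
    have h1 : -μ ∈ spectrum ℂ (M₁.map (algebraMap ℝ ℂ)) := by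
      rw [← spectrum.neg_eq, Set.mem_neg, Matrix.mem_spectrum_iff_isRoot_charpoly] at hμ'
      rw [Matrix.mem_spectrum_iff_isRoot_charpoly, ← Matrix.charpoly_transpose]
      exact hμ'
    have := h₁ _ h1
    rw [Complex.neg_re] at this
    linarith

end Sylvester

section SpoofedARE

variable {A : Matrix (Fin n) (Fin n) ℝ} {Bu : Matrix (Fin n) (Fin m_u) ℝ}
  {Ba : Matrix (Fin n) (Fin m_a) ℝ} {Q : Matrix (Fin n) (Fin n) ℝ}
  {R : Matrix (Fin m_a) (Fin m_a) ℝ} {Λ : Matrix (Fin m_u) (Fin n) ℝ}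

lemma posSemidef_mul_inv_mul_transpose (Ba : Matrix (Fin n) (Fin m_a) ℝ) (hR : R.PosDef) :
    (Ba * R⁻¹ * Baᵀ).PosSemidef := by
  simpa using hR.inv.posSemidef.mul_mul_conjTranspose_same Ba

lemma spoofedARE_quadForm {P : Matrix (Fin n) (Fin n) ℝ} (hP : P.IsHermitian)
    (hare : (A + Bu * Λ)ᵀ * P + P * (A + Bu * Λ) + Q + P * Ba * R⁻¹ * Baᵀ * P = 0)
    (x : Fin n → ℝ) :
    2 * (x ⬝ᵥ P *ᵥ ((A + Bu * Λ) *ᵥ x)) + x ⬝ᵥ Q *ᵥ x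
      + (P *ᵥ x) ⬝ᵥ (Ba * R⁻¹ * Baᵀ) *ᵥ (P *ᵥ x) = 0 := by
  have h := congrArg (fun X => x ⬝ᵥ X *ᵥ x) hare
  simp only [Matrix.zero_mulVec, dotProduct_zero] at h
  rw [Matrix.add_mulVec, dotProduct_add, Matrix.add_mulVec, dotProduct_add,
    dotProduct_lyapunov_mulVec hP] at h
  have hG : P * Ba * R⁻¹ * Baᵀ * P = P * ((Ba * R⁻¹ * Baᵀ) * P) := by
    simp only [Matrix.mul_assoc]
  rw [hG, ← Matrix.mulVec_mulVec, ← Matrix.mulVec_mulVec,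
    dotProduct_mulVec_comm_of_isHermitian hP x ((Ba * R⁻¹ * Baᵀ) *ᵥ (P *ᵥ x)),
    dotProduct_comm _ (P *ᵥ x)] at h
  exact h

lemma posDef_of_spoofedARE {P : Matrix (Fin n) (Fin n) ℝ} (hQ : Q.PosDef) (hP : P.PosSemidef)
    (hare : (A + Bu * Λ)ᵀ * P + P * (A + Bu * Λ) + Q + P * Ba * R⁻¹ * Baᵀ * P = 0) :
    P.PosDef := by
  refine .of_dotProduct_mulVec_pos hP.1 fun x hx => ?_
  refine (hP.dotProduct_mulVec_nonneg x).lt_of_ne' fun h => ?_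
  rw [hP.dotProduct_mulVec_zero_iff] at h
  have hx' := hQ.dotProduct_mulVec_pos hx
  have h2 := spoofedARE_quadForm hP.1 hare x
  rw [dotProduct_mulVec_comm_of_isHermitian hP.1, h] at h2
  simp only [dotProduct_zero, mul_zero, zero_dotProduct, add_zero, zero_add] at h2
  simp [h2] at hx'

lemma neg_le_closedLoop_quadForm {P : Matrix (Fin n) (Fin n) ℝ} (hR : R.PosDef)
    (hP : P.IsHermitian)
    (hare : (A + Bu * Λ)ᵀ * P + P * (A + Bu * Λ) + Q + P * Ba * R⁻¹ * Baᵀ * P = 0)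
    (x : Fin n → ℝ) :
    -(frobNorm Q / 2) * (x ⬝ᵥ x) ≤
      x ⬝ᵥ P *ᵥ ((A + Bu * Λ + Ba * R⁻¹ * Baᵀ * P) *ᵥ x) := by
  have h := spoofedARE_quadForm hP hare x
  have hG := (posSemidef_mul_inv_mul_transpose Ba hR).dotProduct_mulVec_nonneg (P *ᵥ x)
  have hQ := dotProduct_mulVec_le_frobNorm Q x
  have e : x ⬝ᵥ P *ᵥ ((Ba * R⁻¹ * Baᵀ * P) *ᵥ x) =
      (P *ᵥ x) ⬝ᵥ (Ba * R⁻¹ * Baᵀ) *ᵥ (P *ᵥ x) := by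
    rw [dotProduct_mulVec_comm_of_isHermitian hP, ← Matrix.mulVec_mulVec,
      dotProduct_comm (_ *ᵥ _)]
  rw [Matrix.add_mulVec, Matrix.mulVec_add, dotProduct_add, e]
  simp only [star_trivial] at hG
  linarith

lemma IsStabSol.unique {P₁ P₂ : Matrix (Fin n) (Fin n) ℝ} (hR : R.PosDef)
    (h₁ : IsStabSol A Bu Ba Q R Λ P₁) (h₂ : IsStabSol A Bu Ba Q R Λ P₂) : P₁ = P₂ := by
  obtain ⟨hp₁, ha₁, hh₁⟩ := h₁
  obtain ⟨-, ha₂, hh₂⟩ := h₂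
  have hGt : (Ba * R⁻¹ * Baᵀ)ᵀ = Ba * R⁻¹ * Baᵀ := by
    simpa [Matrix.IsHermitian] using (posSemidef_mul_inv_mul_transpose Ba hR).1
  have hP₁ : P₁ᵀ = P₁ := by simpa [Matrix.IsHermitian] using hp₁.1
  rw [← sub_eq_zero]
  refine eq_zero_of_isHurwitz_sylvester hh₁ hh₂ ?_
  have e₁ : P₁ * Ba * R⁻¹ * Baᵀ * P₁ = P₁ * (Ba * R⁻¹ * Baᵀ) * P₁ := by
    simp only [Matrix.mul_assoc]
  have e₂ : P₂ * Ba * R⁻¹ * Baᵀ * P₂ = P₂ * (Ba * R⁻¹ * Baᵀ) * P₂ := by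
    simp only [Matrix.mul_assoc]
  rw [e₁] at ha₁
  rw [e₂] at ha₂
  generalize Ba * R⁻¹ * Baᵀ = G at *
  generalize A + Bu * Λ = F at *
  rw [Matrix.transpose_add, Matrix.transpose_mul, hGt, hP₁]
  calc _ = (Fᵀ * P₁ + P₁ * F + Q + P₁ * G * P₁) - (Fᵀ * P₂ + P₂ * F + Q + P₂ * G * P₂) := by
        noncomm_ring
    _ = 0 := by rw [ha₁, ha₂, sub_self]

end SpoofedARE

lemma dotProduct_mulVec_nominal_eq {S M : Matrix (Fin n) (Fin n) ℝ} (hS : S.IsHermitian)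
    (hSeq : Mᵀ * S + S * M + (2 : ℝ) • (1 : Matrix (Fin n) (Fin n) ℝ) = 0) (x : Fin n → ℝ) :
    x ⬝ᵥ S *ᵥ (M *ᵥ x) = -(x ⬝ᵥ x) := by
  have h := congrArg (fun X => x ⬝ᵥ X *ᵥ x) hSeq
  simp only [Matrix.zero_mulVec, dotProduct_zero] at h
  rw [Matrix.add_mulVec, dotProduct_add, dotProduct_lyapunov_mulVec hS, Matrix.smul_mulVec,
    Matrix.one_mulVec, dotProduct_smul, smul_eq_mul] at h
  linarith

/-- The perturbation budget: gains in the sublevel set perturb the nominal Lyapunov inequality by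
at most `ε`. -/
lemma frobNorm_perturbation_le {Γ : Matrix (Fin m_u) (Fin m_u) ℝ} (hΓ : Γ.PosDef)
    {Kstar Kbar K : Matrix (Fin m_a) (Fin n) ℝ} {Λ : Matrix (Fin m_u) (Fin n) ℝ}
    {a b ε : ℝ} (ha : 0 ≤ a) (hb : 0 ≤ b) (hε : 0 ≤ ε)
    (hdist : frobNorm (Kstar - Kbar) ≤
      (ε / 2) * (√(eigMin Γ) / (√(eigMin Γ) * a + b)))
    (hcost : frobNorm (K - Kbar) ^ 2 + (Λᵀ * Γ * Λ).trace ≤ frobNorm (Kstar - Kbar) ^ 2) :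
    b * frobNorm Λ + a * frobNorm (K - Kstar) ≤ ε := by
  set δ := frobNorm (Kstar - Kbar)
  have hδ0 : 0 ≤ δ := frobNorm_nonneg _
  have htr := trace_transpose_mul_mul_nonneg hΓ Λ
  have hK : frobNorm (K - Kbar) ≤ δ :=
    abs_le_of_sq_le_sq' (by linarith) hδ0 |>.2
  have hKK : frobNorm (K - Kstar) ≤ 2 * δ := by
    have := frobNorm_sub_le (K - Kbar) (Kstar - Kbar)
    rw [sub_sub_sub_cancel_right] at this
    linarith
  set l := √(eigMin Γ) with hl
  have hl0 : 0 ≤ l := Real.sqrt_nonneg _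
  rcases isEmpty_or_nonempty (Fin m_u) with _ | _
  · have hΛ : frobNorm Λ = 0 := by simp [frobNorm_eq_sqrt_sum]
    have hl' : l = 0 := by
      rw [hl, eigMin, dif_pos hΓ.1]
      simp
    rw [hl', zero_div, mul_zero] at hdist
    rw [hΛ]
    nlinarith [mul_le_mul_of_nonneg_left hKK ha]
  have hlpos : 0 < l := Real.sqrt_pos.2 (eigMin_pos hΓ)
  have hΛ : l * frobNorm Λ ≤ δ := by
    refine abs_le_of_sq_le_sq' ?_ hδ0 |>.2
    rw [mul_pow, hl, Real.sq_sqrt (eigMin_pos hΓ).le]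
    nlinarith [eigMin_mul_frobNorm_sq_le hΓ.1 Λ, sq_nonneg (frobNorm (K - Kbar))]
  have hden : δ * (l * a + b) ≤ ε / 2 * l := by
    have hd : 0 ≤ l * a + b := by positivity
    rcases hd.eq_or_lt with h | h
    · rw [← h, mul_zero]
      positivity
    · rwa [← mul_div_assoc, le_div_iff₀ h] at hdist
  refine le_of_mul_le_mul_left ?_ hlpos
  nlinarith [mul_le_mul_of_nonneg_left hΛ hb,
    mul_le_mul_of_nonneg_left hKK (mul_nonneg hl0 ha), mul_nonneg hb hδ0]

lemma isCompact_setOf_abs_apply_le {p q : ℕ} (f : Fin p → Fin q → ℝ) :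
    IsCompact {M : Matrix (Fin p) (Fin q) ℝ | ∀ i j, |M i j| ≤ f i j} := by
  have hc : IsCompact (Set.univ.pi fun i => Set.univ.pi fun j => Set.Icc (-f i j) (f i j) :
      Set (Matrix (Fin p) (Fin q) ℝ)) :=
    isCompact_univ_pi fun i => isCompact_univ_pi fun j => isCompact_Icc
  refine (congrArg IsCompact (Set.ext fun M => ?_)).mp hc
  simp only [Set.mem_ofPred_eq, abs_le]
  exact ⟨fun h i j => h i trivial j trivial, fun h i _ j _ => h i j⟩

lemma exists_frobNorm_le_of_trace_le {m q : ℕ} {Γ : Matrix (Fin m) (Fin m) ℝ} (hΓ : Γ.PosDef)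
    (r : ℝ) : ∃ C : ℝ, ∀ M : Matrix (Fin m) (Fin q) ℝ, (Mᵀ * Γ * M).trace ≤ r →
      frobNorm M ≤ C := by
  rcases isEmpty_or_nonempty (Fin m) with _ | _
  · exact ⟨0, fun M _ => by simp [frobNorm_eq_sqrt_sum]⟩
  refine ⟨√(r / eigMin Γ), fun M hM => Real.le_sqrt_of_sq_le ?_⟩
  rw [le_div_iff₀ (eigMin_pos hΓ), mul_comm]
  exact (eigMin_mul_frobNorm_sq_le hΓ.1 M).trans hM

lemma abs_apply_le_of_posSemidef {p : ℕ} {P : Matrix (Fin p) (Fin p) ℝ} (hP : P.PosSemidef)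
    (i j : Fin p) : |P i j| ≤ (P i i + P j j) / 2 := by
  have hT : P j i = P i j := by simpa using hP.1.apply i j
  have h₁ := hP.dotProduct_mulVec_nonneg (Pi.single i 1 + Pi.single j 1)
  have h₂ := hP.dotProduct_mulVec_nonneg (Pi.single i 1 - Pi.single j 1)
  simp only [star_trivial, Matrix.mulVec_add, Matrix.mulVec_sub, dotProduct_add, dotProduct_sub,
    add_dotProduct, sub_dotProduct, Matrix.mulVec_single_one, single_one_dotProduct,
    Matrix.col_apply, hT] at h₁ h₂
  rw [abs_le]
  constructor <;> linarith

attribute [local instance] Matrix.normedAddCommGroup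

/-- under the strengthened distance condition, `S₀` is compact
(closed and bounded). -/
theorem stmt14
    (A : Matrix (Fin n) (Fin n) ℝ) (Bu : Matrix (Fin n) (Fin m_u) ℝ)
    (Ba : Matrix (Fin n) (Fin m_a) ℝ)
    (Q : Matrix (Fin n) (Fin n) ℝ) (R : Matrix (Fin m_a) (Fin m_a) ℝ)
    (Γ : Matrix (Fin m_u) (Fin m_u) ℝ)
    (hQ : Q.PosDef) (hR : R.PosDef) (hΓ : Γ.PosDef)
    (Kbar : Matrix (Fin m_a) (Fin n) ℝ)
    (Pu : Matrix (Fin m_u) (Fin n) ℝ → Matrix (Fin n) (Fin n) ℝ)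
    (hPu : ∀ Λ, (∃ P, IsStabSol A Bu Ba Q R Λ P) → IsStabSol A Bu Ba Q R Λ (Pu Λ))
    (h0 : ∃ P, IsStabSol A Bu Ba Q R 0 P)
    (S : Matrix (Fin n) (Fin n) ℝ) (hS : S.PosDef)
    (hSeq : (A + Ba * (R⁻¹ * Baᵀ * Pu 0))ᵀ * S + S * (A + Ba * (R⁻¹ * Baᵀ * Pu 0))
      + (2 : ℝ) • (1 : Matrix (Fin n) (Fin n) ℝ) = 0)
    (ε : ℝ) (hε0 : 0 < ε) (hε1 : ε < 1)
    (hdist : frobNorm (R⁻¹ * Baᵀ * Pu 0 - Kbar) ≤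
      (ε / 2) * (Real.sqrt (eigMin Γ) /
        (Real.sqrt (eigMin Γ) * frobNorm (S * Ba) + frobNorm (S * Bu)))) :
    IsCompact (S0 A Bu Ba Q R Γ Kbar Pu) ∧
    IsClosed (S0 A Bu Ba Q R Γ Kbar Pu) ∧
    ∃ C : ℝ, ∀ Λ ∈ S0 A Bu Ba Q R Γ Kbar Pu, frobNorm Λ ≤ C := by
  set Kstar := R⁻¹ * Baᵀ * Pu 0 with hKstar
  set c : ℝ := frobNorm Q / 2 / (1 - ε)
  set δ := frobNorm (Kstar - Kbar) with hδ
  have hJ0 : Jcost Ba R Γ Kbar Pu 0 = δ ^ 2 := by simp [Jcost, hδ, hKstar]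
  have hstable : ∀ (Λ : Matrix (Fin m_u) (Fin n) ℝ) (P : Matrix (Fin n) (Fin n) ℝ),
      frobNorm (R⁻¹ * Baᵀ * P - Kbar) ^ 2 + (Λᵀ * Γ * Λ).trace ≤ δ ^ 2 → ∀ x : Fin n → ℝ,
      x ⬝ᵥ S *ᵥ ((A + Bu * Λ + Ba * R⁻¹ * Baᵀ * P) *ᵥ x) ≤ -(1 - ε) * (x ⬝ᵥ x) := by
    intro Λ P hcost x
    have hM : A + Bu * Λ + Ba * R⁻¹ * Baᵀ * P =
        (A + Ba * Kstar) + (Bu * Λ + Ba * (R⁻¹ * Baᵀ * P - Kstar)) := by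
      rw [Matrix.mul_sub]
      simp only [Matrix.mul_assoc]
      abel
    have hpert := frobNorm_perturbation_le hΓ (frobNorm_nonneg (S * Ba))
      (frobNorm_nonneg (S * Bu)) hε0.le hdist hcost
    have hxx : 0 ≤ x ⬝ᵥ x := by simpa using dotProduct_star_self_nonneg x
    have hu := dotProduct_mulVec_le_frobNorm (S * Bu * Λ) x
    have hu' := mul_le_mul_of_nonneg_right (frobNorm_mul_le (S * Bu) Λ) hxx
    have ha := dotProduct_mulVec_le_frobNorm (S * Ba * (R⁻¹ * Baᵀ * P - Kstar)) x
    have ha' := mul_le_mul_of_nonneg_right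
      (frobNorm_mul_le (S * Ba) (R⁻¹ * Baᵀ * P - Kstar)) hxx
    rw [hM, Matrix.add_mulVec, Matrix.mulVec_add, dotProduct_add,
      dotProduct_mulVec_nominal_eq hS.1 hSeq, Matrix.mulVec_mulVec, Matrix.mul_add,
      ← Matrix.mul_assoc, ← Matrix.mul_assoc, Matrix.add_mulVec, dotProduct_add]
    nlinarith [mul_le_mul_of_nonneg_right hpert hxx]
  let T : Set (Matrix (Fin m_u) (Fin n) ℝ × Matrix (Fin n) (Fin n) ℝ) :=
    {p | p.2ᵀ = p.2 ∧ (∀ x : Fin n → ℝ, 0 ≤ x ⬝ᵥ p.2 *ᵥ x) ∧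
      ((A + Bu * p.1)ᵀ * p.2 + p.2 * (A + Bu * p.1) + Q + p.2 * Ba * R⁻¹ * Baᵀ * p.2 = 0) ∧
      frobNorm (R⁻¹ * Baᵀ * p.2 - Kbar) ^ 2 + (p.1ᵀ * Γ * p.1).trace ≤ δ ^ 2 ∧
      ∀ x : Fin n → ℝ, x ⬝ᵥ p.2 *ᵥ x ≤ c * (x ⬝ᵥ S *ᵥ x)}
  have hTpsd : ∀ p ∈ T, p.2.PosSemidef := fun p hp =>
    .of_dotProduct_mulVec_nonneg (by simpa [Matrix.IsHermitian] using hp.1) (by simpa using hp.2.1)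
  have hTclosed : IsClosed T := by
    have hnonneg : IsClosed {p : Matrix (Fin m_u) (Fin n) ℝ × Matrix (Fin n) (Fin n) ℝ |
        ∀ x : Fin n → ℝ, 0 ≤ x ⬝ᵥ p.2 *ᵥ x} := by
      rw [Set.ofPred_forall]
      exact isClosed_iInter fun x => isClosed_le (by fun_prop) (by fun_prop)
    have hle : IsClosed {p : Matrix (Fin m_u) (Fin n) ℝ × Matrix (Fin n) (Fin n) ℝ |
        ∀ x : Fin n → ℝ, x ⬝ᵥ p.2 *ᵥ x ≤ c * (x ⬝ᵥ S *ᵥ x)} := by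
      rw [Set.ofPred_forall]
      exact isClosed_iInter fun x => isClosed_le (by fun_prop) (by fun_prop)
    exact (isClosed_eq (by fun_prop) (by fun_prop)).inter (hnonneg.inter
      ((isClosed_eq (by fun_prop) (by fun_prop)).inter ((isClosed_le
        (((continuous_frobNorm.comp (by fun_prop)).pow 2).add (by fun_prop)) (by fun_prop)).inter
        hle)))
  obtain ⟨C, hC⟩ := exists_frobNorm_le_of_trace_le (q := n) hΓ (δ ^ 2)
  have htrace : ∀ {Λ : Matrix (Fin m_u) (Fin n) ℝ} {K : Matrix (Fin m_a) (Fin n) ℝ},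
      frobNorm K ^ 2 + (Λᵀ * Γ * Λ).trace ≤ δ ^ 2 → frobNorm Λ ≤ C := fun {Λ K} h =>
    hC Λ (by linarith [sq_nonneg (frobNorm K)])
  have hTcompact : IsCompact T := by
    refine ((isCompact_setOf_abs_apply_le fun _ _ => C).prod
      (isCompact_setOf_abs_apply_le fun i j => c * (S i i + S j j) / 2)).of_isClosed_subset
      hTclosed fun p hp => ⟨fun i j => ?_, fun i j => ?_⟩
    · exact (abs_apply_le_frobNorm _ i j).trans (htrace hp.2.2.2.1)
    · have hdiag : ∀ k, p.2 k k ≤ c * S k k := fun k => by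
        simpa using hp.2.2.2.2 (Pi.single k 1)
      refine (abs_apply_le_of_posSemidef (hTpsd p hp) i j).trans ?_
      linarith [hdiag i, hdiag j]
  have hS0 : S0 A Bu Ba Q R Γ Kbar Pu = Prod.fst '' T := by
    ext Λ
    constructor
    · rintro ⟨hex, hcost⟩
      obtain ⟨hpos, hare, -⟩ := hPu Λ hex
      rw [hJ0] at hcost
      refine ⟨(Λ, Pu Λ), ⟨by simpa [Matrix.IsHermitian] using hpos.1,
        by simpa using hpos.posSemidef.dotProduct_mulVec_nonneg, hare, hcost, ?_⟩, rfl⟩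
      exact dotProduct_mulVec_le_of_lyapunov hS hpos.1 (by linarith)
        (div_nonneg (frobNorm_nonneg Q) zero_le_two) (hstable Λ (Pu Λ) hcost)
        (neg_le_closedLoop_quadForm hR hpos.1 hare)
    · rintro ⟨⟨Λ', P⟩, hp, rfl⟩
      have hstab : IsStabSol A Bu Ba Q R Λ' P := by
        refine ⟨posDef_of_spoofedARE hQ (hTpsd _ hp) hp.2.2.1, hp.2.2.1,
          isHurwitz_of_lyapunov hS fun x hx => (hstable Λ' P hp.2.2.2.1 x).trans_lt ?_⟩
        have hxx : 0 < x ⬝ᵥ x := by simpa using dotProduct_star_self_pos_iff.2 hx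
        nlinarith
      refine ⟨⟨P, hstab⟩, ?_⟩
      rw [hJ0, Jcost, (hPu Λ' ⟨P, hstab⟩).unique hR hstab]
      exact hp.2.2.2.1
  have hcompact : IsCompact (S0 A Bu Ba Q R Γ Kbar Pu) := hS0 ▸ hTcompact.image continuous_fst
  refine ⟨hcompact, hcompact.isClosed, C, fun Λ hΛ => ?_⟩
  have hcost := hΛ.2
  rw [hJ0] at hcost
  exact htrace hcost
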